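/- Let A be the group with presentation ⟨δ, φ, ι | δ^d = φ^f = ι² = 1, δ^φ = δ^p, δ^ι = δ⁻¹, φ^ι = φ⟩ where p is an odd prime, d, f ≥ 1. Then the derived subgroup A' equals ⟨δ²⟩, and every subgroup of A' is integrable within A. -/

import Mathlib

theorem aux_comm_le {G : Type*} [Group G] (N : Subgroup G) [N.Normal] (S : Set G)
    (h : ∀ a ∈ S, ∀ b ∈ S, (a * b)⁻¹ * (b * a) ∈ N) :
    ⁅Subgroup.closure S, Subgroup.closure S⁆ ≤ N := by
  have key : Subgroup.map (QuotientGroup.mk' N) ⁅Subgroup.closure S, Subgroup.closure S⁆ = ⊥ := by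
    rw [Subgroup.map_commutator, MonoidHom.map_closure, Subgroup.commutator_eq_bot_iff_le_centralizer,
      Subgroup.centralizer_closure, Subgroup.closure_le]
    rintro _ ⟨a, ha, rfl⟩
    rw [SetLike.mem_coe, Subgroup.mem_centralizer_iff]
    rintro _ ⟨b, hb, rfl⟩
    rw [← map_mul, ← map_mul]
    exact QuotientGroup.eq.2 (h b hb a ha)
  rw [Subgroup.map_eq_bot_iff, QuotientGroup.ker_mk'] at key
  exact key

/-- Case (1) of Section 3: for the group
`A = ⟨δ, φ, ι ∣ δ^d = φ^f = ι² = 1, δ^φ = δ^p, δ^ι = δ⁻¹, φ^ι = φ⟩` with `p` an odd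
prime, the derived subgroup is `A' = ⟨δ²⟩` and every subgroup of `A'` is integrable
within `A`. -/
theorem stmt10 {A : Type*} [Group A] (δ φ ι : A) (d f p : ℕ)
    (hd : 1 ≤ d) (hf : 1 ≤ f) (hp : p.Prime) (hodd : Odd p)
    (hgen : Subgroup.closure {δ, φ, ι} = ⊤)
    (r1 : δ ^ d = 1) (r2 : φ ^ f = 1) (r3 : ι ^ 2 = 1)
    (r4 : φ⁻¹ * δ * φ = δ ^ p) (r5 : ι⁻¹ * δ * ι = δ⁻¹)
    (r6 : ι⁻¹ * φ * ι = φ) :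
    commutator A = Subgroup.zpowers (δ ^ 2) ∧
    ∀ B : Subgroup A, B ≤ Subgroup.zpowers (δ ^ 2) →
      ∃ C : Subgroup A, ⁅C, C⁆ = B := by
  have hfin : IsOfFinOrder δ := isOfFinOrder_iff_pow_eq_one.2 ⟨d, hd, r1⟩
  have cφ : ∀ m : ℤ, φ⁻¹ * δ ^ m * φ = (δ ^ m) ^ p := by
    intro m
    have := conj_zpow (i := m) (a := φ⁻¹) (b := δ)
    rw [inv_inv, r4] at this
    rw [← this, ← zpow_natCast, ← zpow_natCast, ← zpow_mul, ← zpow_mul, mul_comm]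
  have cι : ∀ m : ℤ, ι⁻¹ * δ ^ m * ι = (δ ^ m)⁻¹ := by
    intro m
    have := conj_zpow (i := m) (a := ι⁻¹) (b := δ)
    rw [inv_inv, r5] at this
    rw [← this, inv_zpow]
  have hnorm : ∀ m : ℤ, (Subgroup.zpowers (δ ^ m)).Normal := by
    intro m
    have : Finite (Subgroup.zpowers (δ ^ m)) := by
      rw [← SetLike.coe_sort_coe]
      exact Set.finite_coe_iff.2 (finite_zpowers.2 hfin.zpow)
    have base : ∀ g : A, g⁻¹ * δ ^ m * g ∈ Subgroup.zpowers (δ ^ m) →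
        g ∈ Subgroup.normalizer (Subgroup.zpowers (δ ^ m) : Set A) := by
      intro g hg
      rw [← inv_mem_iff]
      apply Subgroup.mem_normalizer_fintype
      rintro _ ⟨j, rfl⟩
      have := conj_zpow (i := j) (a := g⁻¹) (b := δ ^ m)
      rw [inv_inv] at this
      simp only [inv_inv, SetLike.mem_coe]
      rw [← this]
      exact zpow_mem hg j
    rw [← Subgroup.normalizer_eq_top_iff, ← top_le_iff, ← hgen, Subgroup.closure_le]
    rintro x (rfl | rfl | rfl)
    · apply base
      have : x⁻¹ * x ^ m * x = x ^ m := by group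
      rw [this]
      exact Subgroup.mem_zpowers _
    · apply base
      rw [cφ]
      exact pow_mem (Subgroup.mem_zpowers _) _
    · apply base
      rw [cι]
      exact inv_mem (Subgroup.mem_zpowers _)
  have hιδ : ∀ k : ℤ, (δ ^ k * ι)⁻¹ * (ι * δ ^ k) = δ ^ (2 * k) := by
    intro k
    have e : ι * δ ^ k = (δ ^ k)⁻¹ * ι := by
      have := cι k
      have h2 : ι⁻¹ = ι := by rw [inv_eq_iff_mul_eq_one, ← sq, r3]
      rw [h2] at this
      rw [← this, mul_assoc, mul_assoc, ← sq, r3, mul_one]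
    have e2 : (δ ^ k * ι)⁻¹ * ((δ ^ k)⁻¹ * ι) = ι⁻¹ * δ ^ (-(2 * k)) * ι := by group
    rw [e, e2, cι, zpow_neg, inv_inv]
  have hge : ∀ (k : ℤ) (C : Subgroup A), δ ^ k ∈ C → ι ∈ C →
      Subgroup.zpowers (δ ^ (2 * k)) ≤ ⁅C, C⁆ := by
    intro k C h1 h2
    rw [Subgroup.zpowers_le, ← hιδ k]
    have := Subgroup.commutator_mem_commutator (inv_mem h2) (inv_mem h1)
    rw [commutatorElement_def] at this
    convert this using 1
    group
  have flip : ∀ (N : Subgroup A) (a b : A), (a * b)⁻¹ * (b * a) ∈ N → (b * a)⁻¹ * (a * b) ∈ N := by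
    intro N a b h
    have := inv_mem h
    rwa [mul_inv_rev, inv_inv] at this
  have self : ∀ (N : Subgroup A) (a : A), (a * a)⁻¹ * (a * a) ∈ N := by
    intro N a
    rw [inv_mul_cancel]; exact one_mem N
  refine ⟨?_, ?_⟩
  · apply le_antisymm
    · have hn := hnorm 2
      rw [commutator_def, ← hgen]
      have e2 : δ ^ 2 = δ ^ (2 : ℤ) := by norm_cast
      rw [e2]
      have h1 : (δ * φ)⁻¹ * (φ * δ) ∈ Subgroup.zpowers (δ ^ (2 : ℤ)) := by
        apply flip
        obtain ⟨q, hq⟩ := hodd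
        have e : (φ * δ)⁻¹ * (δ * φ) = δ⁻¹ * (φ⁻¹ * δ * φ) := by group
        rw [e, r4, hq]
        refine ⟨q, ?_⟩
        simp only
        rw [← zpow_mul, pow_succ', inv_mul_cancel_left, ← zpow_natCast]
        norm_num
      have h2 : (δ * ι)⁻¹ * (ι * δ) ∈ Subgroup.zpowers (δ ^ (2 : ℤ)) := by
        have := hιδ 1
        rw [zpow_one, mul_one] at this
        rw [this]
        exact Subgroup.mem_zpowers _
      have h3 : (φ * ι)⁻¹ * (ι * φ) ∈ Subgroup.zpowers (δ ^ (2 : ℤ)) := by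
        have : ι * φ = φ * ι := by
          conv_lhs => rw [← r6]
          have h2 : ι⁻¹ = ι := by rw [inv_eq_iff_mul_eq_one, ← sq, r3]
          group
        rw [this, inv_mul_cancel]
        exact one_mem _
      apply aux_comm_le
      rintro a (rfl | rfl | rfl) b (rfl | rfl | rfl)
      all_goals first
        | exact self _ _
        | assumption
        | (apply flip; assumption)
    · have := hge 1 ⊤ trivial trivial
      rw [commutator_def]
      simpa using this
  · intro B hB
    have hB2 : ∃ k : ℤ, B = Subgroup.zpowers (δ ^ (2 * k)) := by
      have hc : IsCyclic B := by
        have := Subgroup.isCyclic_of_le hB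
        exact this
      obtain ⟨g, hg⟩ := (Subgroup.isCyclic_iff_exists_zpowers_eq_top B).1 hc
      have hgB : g ∈ B := hg ▸ Subgroup.mem_zpowers g
      obtain ⟨k, rfl⟩ := hB hgB
      refine ⟨k, hg.symm.trans ?_⟩
      rw [zpow_mul]
      norm_cast
    obtain ⟨k, rfl⟩ := hB2
    refine ⟨Subgroup.closure {δ ^ k, ι}, le_antisymm ?_ (hge k _ ?_ ?_)⟩
    · have hn := hnorm (2 * k)
      have h2 : (δ ^ k * ι)⁻¹ * (ι * δ ^ k) ∈ Subgroup.zpowers (δ ^ (2 * k)) := by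
        rw [hιδ k]
        exact Subgroup.mem_zpowers _
      apply aux_comm_le
      rintro a (rfl | rfl) b (rfl | rfl)
      all_goals first
        | exact self _ _
        | assumption
        | (apply flip; assumption)
    · exact Subgroup.subset_closure (by simp)
    · exact Subgroup.subset_closure (by simp)
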